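/- Let 𝒯 be a finite undirected tree with maximum degree Δ and w : V(𝒯) → ℝ≥0 a weight function. Then cent(𝒯,w) ≤ (2 − 1/2^Δ)·OPT(𝒯,w). -/

import Mathlib

open Filter Topology

universe u

variable {V : Type u}

/-- Rooted trees with vertices labelled by elements of `V`. -/
inductive RTree (V : Type u) : Type u where
  | node : V → List (RTree V) → RTree V

namespace RTree

/-- The root of a rooted tree. -/
def root : RTree V → V
  | node r _ => r

/-- The subtrees rooted at the children of the root. -/
def children : RTree V → List (RTree V)
  | node _ ts => ts

/-- The list of pairs `(v, path from the root to v)` over all vertices `v` of the tree. -/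
def pathsFrom : RTree V → List (V × List V)
  | node r ts =>
      (r, [r]) ::
        (ts.attach.map fun t => (t.1.pathsFrom.map fun p => (p.1, r :: p.2))).flatten
  decreasing_by
    simp only [RTree.node.sizeOf_spec]
    have := List.sizeOf_lt_of_mem t.2
    omega

/-- The vertex set of a rooted tree. -/
def vertSet (T : RTree V) : Set V := {v | ∃ p ∈ T.pathsFrom, p.1 = v}

/-- `Path_T(v)`: the set of vertices on the path in `T` from the root to `v`
(including both endpoints). -/
def pathSet (T : RTree V) (v : V) : Set V := {x | ∃ p ∈ T.pathsFrom, p.1 = v ∧ x ∈ p.2}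

/-- The depth of a vertex `v` in `T`; the root has depth 1. -/
noncomputable def depth (T : RTree V) (v : V) : ℕ := (T.pathSet v).ncard

/-- All subtrees of a rooted tree (including the tree itself). -/
def allSubtrees : RTree V → List (RTree V)
  | node r ts => node r ts :: (ts.attach.map fun t => t.1.allSubtrees).flatten
  decreasing_by
    simp only [RTree.node.sizeOf_spec]
    have := List.sizeOf_lt_of_mem t.2
    omega

/-- Two rooted trees are equivalent (represent the same search tree) if they have
the same root-to-vertex paths. -/
def Equiv (T₁ T₂ : RTree V) : Prop := ∀ v, T₁.pathSet v = T₂.pathSet v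

end RTree

/-- `x` and `y` are joined by a walk of `G` staying inside `s`. -/
def ReachIn (G : SimpleGraph V) (s : Set V) (x y : V) : Prop :=
  ∃ p : G.Walk x y, ∀ v ∈ p.support, v ∈ s

/-- The connected component of `x` in the subgraph of `G` induced by `s`. -/
def compIn (G : SimpleGraph V) (s : Set V) (x : V) : Set V := {y | ReachIn G s x y}

/-- The set of connected components of the subgraph of `G` induced by `s`. -/
def comps (G : SimpleGraph V) (s : Set V) : Set (Set V) := {c | ∃ x ∈ s, c = compIn G s x}

/-- `s` induces a (nonempty) connected subgraph of `G`. -/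
def ConnIn (G : SimpleGraph V) (s : Set V) : Prop :=
  s.Nonempty ∧ ∀ x ∈ s, ∀ y ∈ s, ReachIn G s x y

/-- The total weight of a set of vertices. -/
noncomputable def wsum (w : V → ℝ) (s : Set V) : ℝ := ∑ᶠ x ∈ s, w x

/-- `IsSearchTree G s T`: `T` is a search tree on the subgraph of `G` induced by `s`.
Its root `r` is a vertex of `s`, its vertex set is `s`, and the subtrees rooted at the
children of `r` are search trees on the connected components of the induced subgraph
on `s \ {r}` (one subtree for each component). -/
inductive IsSearchTree (G : SimpleGraph V) : Set V → RTree V → Prop where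
  | node {s : Set V} {r : V} {ts : List (RTree V)} :
      r ∈ s →
      (RTree.node r ts).vertSet = s →
      (∀ t ∈ ts, IsSearchTree G (compIn G (s \ {r}) t.root) t) →
      ts.Pairwise (fun t₁ t₂ => compIn G (s \ {r}) t₁.root ≠ compIn G (s \ {r}) t₂.root) →
      IsSearchTree G s (RTree.node r ts)

/-- The cost of a search tree: `∑_x w(x) · depth(x)`, the root having depth 1. -/
noncomputable def cost (w : V → ℝ) (T : RTree V) : ℝ :=
  ∑ᶠ v ∈ T.vertSet, w v * (T.depth v : ℝ)

/-- The optimum cost of a search tree on the subgraph of `G` induced by `s`. -/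
noncomputable def OPT (G : SimpleGraph V) (w : V → ℝ) (s : Set V) : ℝ :=
  sInf (cost w '' {T | IsSearchTree G s T})

/-- `v` is an `α`-centroid of the subgraph of `G` induced by `s` (with weights `w`):
every connected component of the induced subgraph on `s \ {v}` has weight at most
`α` times the weight of `s`. -/
def IsAlphaCentroid (G : SimpleGraph V) (w : V → ℝ) (α : ℝ) (s : Set V) (v : V) : Prop :=
  v ∈ s ∧ ∀ x ∈ s \ {v}, wsum w (compIn G (s \ {v}) x) ≤ α * wsum w s

/-- `v` is a centroid of the subgraph of `G` induced by `s` (with weights `w`). -/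
def IsCentroid (G : SimpleGraph V) (w : V → ℝ) (s : Set V) (v : V) : Prop :=
  v ∈ s ∧ ∀ x ∈ s \ {v}, wsum w (compIn G (s \ {v}) x) ≤ wsum w s / 2

/-- `T` is an `α`-centroid tree on the subgraph of `G` induced by `s`. -/
def IsAlphaCentroidTree (G : SimpleGraph V) (w : V → ℝ) (α : ℝ) (s : Set V) (T : RTree V) :
    Prop :=
  IsSearchTree G s T ∧ ∀ t ∈ T.allSubtrees, IsAlphaCentroid G w α t.vertSet t.root

/-- `T` is a centroid tree on the subgraph of `G` induced by `s`. -/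
def IsCentroidTree (G : SimpleGraph V) (w : V → ℝ) (s : Set V) (T : RTree V) : Prop :=
  IsSearchTree G s T ∧ ∀ t ∈ T.allSubtrees, IsCentroid G w t.vertSet t.root

/-- `cent(𝒯,w)`: the maximum cost of a centroid tree. -/
noncomputable def centCost (G : SimpleGraph V) (w : V → ℝ) (s : Set V) : ℝ :=
  sSup (cost w '' {T | IsCentroidTree G w s T})

/-- `centᵅ(𝒯,w)`: the maximum cost of an `α`-centroid tree (`0` if none exists, since
`sSup ∅ = 0` in `ℝ`). -/
noncomputable def centCostA (G : SimpleGraph V) (w : V → ℝ) (α : ℝ) (s : Set V) : ℝ :=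
  sSup (cost w '' {T | IsAlphaCentroidTree G w α s T})

/-- `b` is a child of `a` in the rooted tree `T`. -/
def ChildRel (T : RTree V) (a b : V) : Prop :=
  ∃ t ∈ T.allSubtrees, t.root = a ∧ ∃ t' ∈ t.children, t'.root = b

namespace RTree

theorem mem_pathsFrom_node {r : V} {ts : List (RTree V)} {p : V × List V} :
    p ∈ (node r ts).pathsFrom ↔
      p = (r, [r]) ∨ ∃ t ∈ ts, ∃ q ∈ t.pathsFrom, (q.1, r :: q.2) = p := by
  rw [pathsFrom]
  simp

theorem mem_vertSet_node {r : V} {ts : List (RTree V)} {v : V} :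
    v ∈ (node r ts).vertSet ↔ v = r ∨ ∃ t ∈ ts, v ∈ t.vertSet := by
  simp only [vertSet, Set.mem_ofPred_eq, mem_pathsFrom_node]
  constructor
  · rintro ⟨p, rfl | ⟨t, ht, q, hq, rfl⟩, rfl⟩
    · exact .inl rfl
    · exact .inr ⟨t, ht, q, hq, rfl⟩
  · rintro (rfl | ⟨t, ht, q, hq, rfl⟩)
    · exact ⟨_, .inl rfl, rfl⟩
    · exact ⟨_, .inr ⟨t, ht, q, hq, rfl⟩, rfl⟩

/-- The set of descendants of `x` (including `x`) in a rooted tree. -/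
def descSet (T : RTree V) (x : V) : Set V := {v | x ∈ T.pathSet v}

theorem mem_descSet_node {r : V} {ts : List (RTree V)} {x v : V} :
    v ∈ (node r ts).descSet x ↔
      (x = r ∧ v = r) ∨ ∃ t ∈ ts, (x = r ∧ v ∈ t.vertSet) ∨ v ∈ t.descSet x := by
  simp only [descSet, pathSet, vertSet, Set.mem_ofPred_eq, mem_pathsFrom_node]
  constructor
  · rintro ⟨p, rfl | ⟨t, ht, q, hq, rfl⟩, rfl, hx⟩
    · exact .inl ⟨by simpa using hx, rfl⟩
    · rcases List.mem_cons.1 hx with rfl | hx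
      · exact .inr ⟨t, ht, .inl ⟨rfl, q, hq, rfl⟩⟩
      · exact .inr ⟨t, ht, .inr ⟨q, hq, rfl, hx⟩⟩
  · rintro (⟨rfl, rfl⟩ | ⟨t, ht, ⟨rfl, q, hq, rfl⟩ | ⟨q, hq, rfl, hx⟩⟩)
    · exact ⟨_, .inl rfl, rfl, by simp⟩
    · exact ⟨_, .inr ⟨t, ht, q, hq, rfl⟩, rfl, by simp⟩
    · exact ⟨_, .inr ⟨t, ht, q, hq, rfl⟩, rfl, by simp [hx]⟩

theorem mem_allSubtrees_node {r : V} {ts : List (RTree V)} {T : RTree V} :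
    T ∈ (node r ts).allSubtrees ↔ T = node r ts ∨ ∃ t ∈ ts, T ∈ t.allSubtrees := by
  rw [allSubtrees]
  simp

end RTree

section Reach

variable {G : SimpleGraph V} {s t : Set V} {x y z : V}

theorem ReachIn.refl (hx : x ∈ s) : ReachIn G s x x :=
  ⟨.nil, by simpa using hx⟩

theorem ReachIn.symm (h : ReachIn G s x y) : ReachIn G s y x := by
  obtain ⟨p, hp⟩ := h
  exact ⟨p.reverse, by simpa using hp⟩

theorem ReachIn.trans (h : ReachIn G s x y) (h' : ReachIn G s y z) : ReachIn G s x z := by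
  obtain ⟨p, hp⟩ := h
  obtain ⟨q, hq⟩ := h'
  refine ⟨p.append q, fun v hv => ?_⟩
  rcases (SimpleGraph.Walk.mem_support_append_iff _ _).1 hv with hv | hv
  exacts [hp v hv, hq v hv]

theorem ReachIn.mono (hst : s ⊆ t) (h : ReachIn G s x y) : ReachIn G t x y := by
  obtain ⟨p, hp⟩ := h
  exact ⟨p, fun v hv => hst (hp v hv)⟩

theorem ReachIn.left_mem (h : ReachIn G s x y) : x ∈ s := by
  obtain ⟨p, hp⟩ := h
  exact hp _ p.start_mem_support

theorem compIn_subset : compIn G s x ⊆ s := fun _ h => (ReachIn.symm h).left_mem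

theorem mem_compIn_self (hx : x ∈ s) : x ∈ compIn G s x := ReachIn.refl hx

theorem compIn_eq_of_mem (h : y ∈ compIn G s x) : compIn G s y = compIn G s x :=
  Set.ext fun _ => ⟨fun hz => ReachIn.trans h hz, fun hz => (ReachIn.symm h).trans hz⟩

theorem ConnIn.subset_compIn (hs : ConnIn G s) (hst : s ⊆ t) (hx : x ∈ s) :
    s ⊆ compIn G t x := fun y hy => (hs.2 x hx y hy).mono hst

theorem connIn_compIn (hx : x ∈ s) : ConnIn G (compIn G s x) := by
  classical
  have key : ∀ y ∈ compIn G s x, ReachIn G (compIn G s x) x y := by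
    rintro y ⟨p, hp⟩
    refine ⟨p, fun v hv => ⟨p.takeUntil v hv, fun z hz => hp z ?_⟩⟩
    exact p.support_takeUntil_subset_support hv hz
  exact ⟨⟨x, mem_compIn_self hx⟩, fun y hy z hz => (key y hy).symm.trans (key z hz)⟩

theorem ConnIn.union (hs : ConnIn G s) (ht : ConnIn G t) (hxs : x ∈ s) (hxt : x ∈ t) :
    ConnIn G (s ∪ t) := by
  have key : ∀ y ∈ s ∪ t, ReachIn G (s ∪ t) x y := by
    rintro y (hy | hy)
    · exact (hs.2 x hxs y hy).mono Set.subset_union_left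
    · exact (ht.2 x hxt y hy).mono Set.subset_union_right
  exact ⟨⟨x, .inl hxs⟩, fun y hy z hz => (key y hy).symm.trans (key z hz)⟩

/-- Every component of a connected set minus a vertex contains a neighbour of that vertex. -/
theorem ConnIn.exists_adj_mem_compIn (hs : ConnIn G s) (hx : x ∈ s) (hy : y ∈ s) (hyx : y ≠ x) :
    ∃ n ∈ compIn G (s \ {x}) y, G.Adj x n := by
  classical
  obtain ⟨p, hp⟩ := hs.2 x hx y hy
  have hq : p.toPath.1.IsPath := p.toPath.2
  have hqs : ∀ v ∈ p.toPath.1.support, v ∈ s := fun v hv =>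
    hp v (p.support_toPath_subset_support hv)
  generalize p.toPath.1 = q at hq hqs
  cases q with
  | nil => exact absurd rfl hyx
  | @cons _ n _ h q =>
    rw [SimpleGraph.Walk.cons_isPath_iff] at hq
    refine ⟨n, ReachIn.symm ⟨q, fun v hv => ⟨hqs v (by simp [hv]), ?_⟩⟩, h⟩
    rintro rfl
    exact hq.2 hv

end Reach

/-- `D v` is the set of descendants of `v` in a search tree on the subgraph of `G` induced
by `s`. -/
structure IsDescMap (G : SimpleGraph V) (s : Set V) (D : V → Set V) : Prop where
  mem_of_mem : ∀ {u v}, u ∈ D v → v ∈ s ∧ u ∈ s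
  self_mem : ∀ {v}, v ∈ s → v ∈ D v
  trans : ∀ {u v}, u ∈ D v → D u ⊆ D v
  antisymm : ∀ {u v}, u ∈ D v → v ∈ D u → u = v
  conn : ∀ {v}, v ∈ s → ConnIn G (D v)
  comp : ∀ {u v}, u ∈ D v → u ≠ v → ∃ u' ∈ s, D u' = compIn G (D v \ {v}) u
  root : ∃ r, D r = s

theorem IsSearchTree.vertSet_eq {G : SimpleGraph V} {s : Set V} {T : RTree V}
    (h : IsSearchTree G s T) : T.vertSet = s := by
  cases h; assumption

theorem IsSearchTree.root_mem {G : SimpleGraph V} {s : Set V} {T : RTree V}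
    (h : IsSearchTree G s T) : T.root ∈ s := by
  cases h; assumption

/-- The structure of the descendant sets at the root of a search tree. -/
theorem IsSearchTree.descSet_node {G : SimpleGraph V} {s : Set V} {r : V} {ts : List (RTree V)}
    (hvs : (RTree.node r ts).vertSet = s)
    (hts : ∀ t ∈ ts, IsSearchTree G (compIn G (s \ {r}) t.root) t)
    (hpw : ts.Pairwise fun t₁ t₂ => compIn G (s \ {r}) t₁.root ≠ compIn G (s \ {r}) t₂.root)
    (hmem : ∀ t ∈ ts, ∀ u v, u ∈ t.descSet v → v ∈ compIn G (s \ {r}) t.root) :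
    (RTree.node r ts).descSet r = s ∧
      ∀ v, v ≠ r → (v ∈ s → ∃ t ∈ ts, v ∈ compIn G (s \ {r}) t.root) ∧
        (∀ t ∈ ts, v ∈ compIn G (s \ {r}) t.root →
          (RTree.node r ts).descSet v = t.descSet v) ∧
        (∀ u ∈ (RTree.node r ts).descSet v, ∃ t ∈ ts, u ∈ t.descSet v) := by
  refine ⟨?_, fun v hv => ⟨fun hvS => ?_, fun t ht hvt => ?_, fun u hu => ?_⟩⟩
  · ext u
    rw [← hvs, RTree.mem_descSet_node, RTree.mem_vertSet_node]
    constructor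
    · rintro (⟨-, h⟩ | ⟨t, ht, ⟨-, h⟩ | h⟩)
      · exact .inl h
      · exact .inr ⟨t, ht, h⟩
      · exact absurd rfl (compIn_subset (hmem t ht _ _ h)).2
    · rintro (h | ⟨t, ht, h⟩)
      · exact .inl ⟨rfl, h⟩
      · exact .inr ⟨t, ht, .inl ⟨rfl, h⟩⟩
  · rw [← hvs, RTree.mem_vertSet_node] at hvS
    obtain ⟨t, ht, h⟩ := hvS.resolve_left hv
    exact ⟨t, ht, (hts t ht).vertSet_eq ▸ h⟩
  · ext u
    rw [RTree.mem_descSet_node]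
    constructor
    · rintro (⟨h, -⟩ | ⟨t', ht', ⟨h, -⟩ | h⟩)
      · exact absurd h hv
      · exact absurd h hv
      · by_cases hne : t = t'
        · exact hne ▸ h
        · have : Std.Symm fun t₁ t₂ : RTree V =>
              compIn G (s \ {r}) t₁.root ≠ compIn G (s \ {r}) t₂.root := ⟨fun _ _ h => h.symm⟩
          refine absurd ?_ (hpw.forall ht ht' hne)
          rw [← compIn_eq_of_mem hvt, ← compIn_eq_of_mem (hmem t' ht' _ _ h)]
    · exact fun h => .inr ⟨t, ht, .inr h⟩
  · rw [RTree.mem_descSet_node] at hu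
    rcases hu with ⟨h, -⟩ | ⟨t', ht', ⟨h, -⟩ | h⟩
    · exact absurd h hv
    · exact absurd h hv
    · exact ⟨t', ht', h⟩

theorem IsSearchTree.isDescMap {G : SimpleGraph V} {s : Set V} {T : RTree V}
    (h : IsSearchTree G s T) (hs : ConnIn G s) :
    IsDescMap G s T.descSet ∧
      ∀ v ∈ s, ∃ t ∈ T.allSubtrees, t.root = v ∧ t.vertSet = T.descSet v := by
  induction h with
  | @node s r ts hr hvs hts hpw ih =>
    have hK : ∀ t ∈ ts, t.root ∈ s \ {r} := fun t ht => ReachIn.left_mem (hts t ht).root_mem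
    replace ih := fun t ht => ih t ht (connIn_compIn (hK t ht))
    obtain ⟨hDr, hD⟩ := IsSearchTree.descSet_node hvs hts hpw
      fun t ht u v h => ((ih t ht).1.mem_of_mem h).1
    have hcase : ∀ {u v}, u ∈ (RTree.node r ts).descSet v → v ≠ r → ∃ t ∈ ts,
        v ∈ compIn G (s \ {r}) t.root ∧ u ∈ compIn G (s \ {r}) t.root ∧ u ∈ t.descSet v ∧
        (RTree.node r ts).descSet v = t.descSet v ∧
        (RTree.node r ts).descSet u = t.descSet u := by
      intro u v hu hv
      obtain ⟨t, ht, hut⟩ := (hD v hv).2.2 u hu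
      obtain ⟨hvK, huK⟩ := (ih t ht).1.mem_of_mem hut
      exact ⟨t, ht, hvK, huK, hut, (hD v hv).2.1 t ht hvK,
        (hD u (compIn_subset huK).2).2.1 t ht huK⟩
    have hmem : ∀ {u v}, u ∈ (RTree.node r ts).descSet v → v ∈ s ∧ u ∈ s := by
      intro u v hu
      by_cases hv : v = r
      · subst hv; exact ⟨hr, hDr ▸ hu⟩
      · obtain ⟨t, ht, hvK, huK, -⟩ := hcase hu hv
        exact ⟨(compIn_subset hvK).1, (compIn_subset huK).1⟩
    refine ⟨⟨hmem, fun {v} hv => ?_, fun {u v} hu => ?_, fun {u v} hu hv => ?_, fun {v} hv => ?_,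
      fun {u v} hu huv => ?_, ⟨r, hDr⟩⟩, fun v hv => ?_⟩
    · by_cases hvr : v = r
      · subst hvr; rwa [hDr]
      · obtain ⟨t, ht, hvK⟩ := (hD v hvr).1 hv
        rw [(hD v hvr).2.1 t ht hvK]
        exact (ih t ht).1.self_mem hvK
    · by_cases hvr : v = r
      · subst hvr
        exact fun x hx => hDr ▸ (hmem hx).2
      · obtain ⟨t, ht, hvK, huK, hut, h₁, h₂⟩ := hcase hu hvr
        rw [h₁, h₂]
        exact (ih t ht).1.trans hut
    · by_cases hvr : v = r
      · by_contra hne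
        obtain ⟨t, ht, huK, hvK, -⟩ := hcase hv (hvr ▸ hne)
        exact (compIn_subset hvK).2 hvr
      · obtain ⟨t, ht, hvK, huK, hut, h₁, h₂⟩ := hcase hu hvr
        exact (ih t ht).1.antisymm hut (h₂ ▸ hv)
    · by_cases hvr : v = r
      · subst hvr; rwa [hDr]
      · obtain ⟨t, ht, hvK⟩ := (hD v hvr).1 hv
        rw [(hD v hvr).2.1 t ht hvK]
        exact (ih t ht).1.conn hvK
    · by_cases hvr : v = r
      · subst hvr
        rw [hDr] at hu ⊢
        obtain ⟨t, ht, huK⟩ := (hD u huv).1 hu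
        obtain ⟨r', hr'⟩ := (ih t ht).1.root
        have hr'K : r' ∈ compIn G (s \ {v}) t.root :=
          ((ih t ht).1.mem_of_mem (hr'.symm ▸ huK)).1
        refine ⟨r', (compIn_subset hr'K).1, ?_⟩
        rw [(hD r' (compIn_subset hr'K).2).2.1 t ht hr'K, hr', compIn_eq_of_mem huK]
      · obtain ⟨t, ht, hvK, huK, hut, h₁, h₂⟩ := hcase hu hvr
        obtain ⟨u', hu'K, hu'⟩ := (ih t ht).1.comp hut huv
        refine ⟨u', (compIn_subset hu'K).1, ?_⟩
        rw [(hD u' (compIn_subset hu'K).2).2.1 t ht hu'K, hu', h₁]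
    · by_cases hvr : v = r
      · subst hvr
        exact ⟨_, RTree.mem_allSubtrees_node.2 (.inl rfl), rfl, by rw [hDr, hvs]⟩
      · obtain ⟨t, ht, hvK⟩ := (hD v hvr).1 hv
        obtain ⟨t', ht', h₁, h₂⟩ := (ih t ht).2 v hvK
        exact ⟨t', RTree.mem_allSubtrees_node.2 (.inr ⟨t, ht, ht'⟩), h₁,
          by rw [(hD v hvr).2.1 t ht hvK, h₂]⟩

section Weight

variable [Fintype V] {w : V → ℝ} {s t : Set V}

theorem wsum_eq_sum_indicator (w : V → ℝ) (s : Set V) : wsum w s = ∑ x, s.indicator w x := by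
  rw [wsum, finsum_mem_def, finsum_eq_sum_of_fintype]

theorem wsum_mono (hw : ∀ x, 0 ≤ w x) (hst : s ⊆ t) : wsum w s ≤ wsum w t := by
  simp only [wsum_eq_sum_indicator]
  exact Finset.sum_le_sum fun x _ => Set.indicator_le_indicator_of_subset hst hw x

theorem wsum_nonneg (hw : ∀ x, 0 ≤ w x) : 0 ≤ wsum w s := by
  rw [wsum_eq_sum_indicator]
  exact Finset.sum_nonneg fun x _ => Set.indicator_nonneg (fun x _ => hw x) x

theorem wsum_diff_of_subset (hst : s ⊆ t) : wsum w (t \ s) = wsum w t - wsum w s := by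
  simp only [wsum_eq_sum_indicator]
  rw [← Finset.sum_sub_distrib]
  refine Finset.sum_congr rfl fun x _ => ?_
  by_cases hs : x ∈ s
  · simp [hs, hst hs]
  · by_cases ht : x ∈ t <;> simp [hs, ht]

theorem sum_wsum_eq {ι : Type*} (I : Finset ι) (A : ι → Set V) [∀ x, DecidablePred (x ∈ A ·)] :
    ∑ i ∈ I, wsum w (A i) = ∑ x, ((I.filter (x ∈ A ·)).card : ℝ) * w x := by
  simp only [wsum_eq_sum_indicator]
  rw [Finset.sum_comm]
  refine Finset.sum_congr rfl fun x _ => ?_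
  simp [Set.indicator_apply, Finset.sum_ite]

/-- Disjoint subsets of `t` have total weight at most the weight of `t`. -/
theorem sum_wsum_le_of_disjoint {ι : Type*} (hw : ∀ x, 0 ≤ w x) (I : Finset ι) (A : ι → Set V)
    (hA : ∀ i ∈ I, A i ⊆ t) (hdisj : ∀ i ∈ I, ∀ j ∈ I, ∀ x ∈ A i, x ∈ A j → i = j) :
    ∑ i ∈ I, wsum w (A i) ≤ wsum w t := by
  classical
  rw [sum_wsum_eq, wsum_eq_sum_indicator]
  refine Finset.sum_le_sum fun x _ => ?_
  have hcard : (I.filter (x ∈ A ·)).card ≤ 1 := by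
    refine Finset.card_le_one.2 fun i hi j hj => ?_
    rw [Finset.mem_filter] at hi hj
    exact hdisj i hi.1 j hj.1 x hi.2 hj.2
  by_cases hx : x ∈ t
  · rw [Set.indicator_of_mem hx]
    exact mul_le_of_le_one_left (hw x) (by exact_mod_cast hcard)
  · rw [Set.indicator_of_notMem hx, Finset.filter_false_of_mem fun i hi h => hx (hA i hi h)]
    simp

end Weight

namespace IsDescMap

variable {G : SimpleGraph V} {s S : Set V} {D : V → Set V} {u v x : V}

theorem exists_top [Finite V] (h : IsDescMap G s D) (hS : ConnIn G S) (hSs : S ⊆ s) :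
    ∃ v ∈ S, S ⊆ D v := by
  obtain ⟨r, hr⟩ := h.root
  obtain ⟨v, hv, hmin⟩ := Set.exists_min_image {v | S ⊆ D v}
    (fun v => (D v).ncard) (Set.toFinite _) ⟨r, (hr ▸ hSs : S ⊆ D r)⟩
  refine ⟨v, ?_, hv⟩
  by_contra hvS
  obtain ⟨x, hx⟩ := hS.1
  have hSv : S ⊆ D v \ {v} := fun y hy => ⟨hv hy, fun h => hvS (h ▸ hy)⟩
  obtain ⟨u, hu, hDu⟩ := h.comp (hv hx) (hSv hx).2
  have hlt : (D u).ncard < (D v).ncard := by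
    refine Set.ncard_lt_ncard ⟨?_, fun hle => ?_⟩ (Set.toFinite _)
    · exact hDu ▸ compIn_subset.trans Set.sdiff_subset
    · have := hle (h.self_mem (h.mem_of_mem (hv hx)).1)
      rw [hDu] at this
      exact (compIn_subset this).2 rfl
  exact absurd (hmin u (hDu ▸ hS.subset_compIn hSv hx : S ⊆ D u)) (not_le.2 hlt)

theorem laminar [Finite V] (h : IsDescMap G s D) (hu : x ∈ D u) (hv : x ∈ D v) :
    u ∈ D v ∨ v ∈ D u := by
  have hus := (h.mem_of_mem hu).1
  have hvs := (h.mem_of_mem hv).1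
  obtain ⟨z, hz, hsub⟩ := h.exists_top ((h.conn hus).union (h.conn hvs) hu hv)
    (Set.union_subset (fun _ hy => (h.mem_of_mem hy).2) fun _ hy => (h.mem_of_mem hy).2)
  rcases hz with hz | hz
  · have := h.antisymm hz (hsub (.inl (h.self_mem hus)))
    exact .inr (this ▸ hsub (.inr (h.self_mem hvs)))
  · have := h.antisymm hz (hsub (.inr (h.self_mem hvs)))
    exact .inl (this ▸ hsub (.inl (h.self_mem hus)))

theorem subset_compIn (h : IsDescMap G s D) (hx : x ∈ D u) (huv : D u ⊆ D v) (hne : v ∉ D u) :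
    D u ⊆ compIn G (D v \ {v}) x :=
  (h.conn (h.mem_of_mem hx).1).subset_compIn
    (fun _ hy => ⟨huv hy, fun hyv => hne (hyv ▸ hy)⟩) hx

end IsDescMap

/-- The children of `v` in the search tree with descendant map `D`. -/
def childSet (G : SimpleGraph V) (D : V → Set V) (v : V) : Set V :=
  {u | u ∈ D v \ {v} ∧ D u = compIn G (D v \ {v}) u}

namespace IsDescMap

variable {G : SimpleGraph V} {s : Set V} {D : V → Set V} {u u' v x r : V}

theorem notMem_of_mem_childSet (hu : u ∈ childSet G D v) : v ∉ D u := fun hv => by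
  rw [hu.2] at hv
  exact (compIn_subset hv).2 rfl

theorem eq_of_mem_childSet (h : IsDescMap G s D) (hu : u ∈ childSet G D v)
    (hu' : u' ∈ childSet G D v) (hx : x ∈ D u) (hx' : x ∈ D u') : u = u' := by
  have hus := (h.mem_of_mem hx).1
  have hus' := (h.mem_of_mem hx').1
  have heq : D u = D u' := by
    rw [hu.2] at hx ⊢
    rw [hu'.2] at hx' ⊢
    rw [← compIn_eq_of_mem hx, ← compIn_eq_of_mem hx']
  exact h.antisymm (heq ▸ h.self_mem hus) (heq ▸ h.self_mem hus')

theorem exists_parent [Finite V] (h : IsDescMap G s D) (hr : D r = s) (hu : u ∈ s) (hur : u ≠ r) :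
    ∃ v, u ∈ childSet G D v := by
  obtain ⟨v, ⟨hv, hvu⟩, hmin⟩ := Set.exists_min_image {v | u ∈ D v ∧ u ≠ v}
    (fun v => (D v).ncard) (Set.toFinite _) ⟨r, hr.symm ▸ hu, hur⟩
  refine ⟨v, ⟨hv, hvu⟩, ?_⟩
  obtain ⟨u', hu's, hDu'⟩ := h.comp hv hvu
  by_cases hne : u = u'
  · rw [← hDu', ← hne]
  have huu' : u ∈ D u' := hDu' ▸ mem_compIn_self ⟨hv, hvu⟩
  refine absurd (hmin u' ⟨huu', hne⟩) (not_le.2 (Set.ncard_lt_ncard ⟨?_, fun hle => ?_⟩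
    (Set.toFinite _)))
  · exact hDu' ▸ compIn_subset.trans Set.sdiff_subset
  · have := hle (h.self_mem (h.mem_of_mem hv).1)
    rw [hDu'] at this
    exact (compIn_subset this).2 rfl

theorem ncard_childSet_le [Finite V] (h : IsDescMap G s D) (v : V) :
    (childSet G D v).ncard ≤ (G.neighborSet v).ncard := by
  have hex : ∀ u ∈ childSet G D v, ∃ n ∈ D u, G.Adj v n := by
    intro u hu
    have hvs := (h.mem_of_mem hu.1.1).1
    rw [hu.2]
    exact (h.conn hvs).exists_adj_mem_compIn (h.self_mem hvs) hu.1.1 hu.1.2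
  choose! f hf hadj using hex
  refine Set.ncard_le_ncard_of_injOn f (fun u hu => hadj u hu) (fun u hu u' hu' he => ?_)
    (Set.toFinite _)
  exact h.eq_of_mem_childSet hu hu' (hf u hu) (he ▸ hf u' hu')

end IsDescMap

section Chains

variable {G : SimpleGraph V} {D E : V → Set V}

/-- The vertices `c` such that `v` is the topmost vertex of `E c` in the tree given by `D`. -/
def chain (D E : V → Set V) (v : V) : Set V := {c | v ∈ E c ∧ E c ⊆ D v}

/-- The part of `E c` that deleting `c` separates from `v`. -/
def cutPart (G : SimpleGraph V) (E : V → Set V) (v c : V) : Set V :=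
  E c \ compIn G (E c \ {c}) v

/-- The union of the subtrees whose topmost vertex is `v`. -/
def chainUnion (D E : V → Set V) (v : V) : Set V := {x | ∃ c ∈ chain D E v, x ∈ E c}

/-- The descendants of `v` that are neither `v` nor covered by `chainUnion` at a child of `v`. -/
def slackPart (G : SimpleGraph V) (D E : V → Set V) (v : V) : Set V :=
  {x | x ∈ D v ∧ x ≠ v ∧ ∀ u ∈ childSet G D v, x ∉ chainUnion D E u}

variable {v c c' u x : V}

theorem exists_next (hE : IsDescMap G Set.univ E) (hc : c ∈ chain D E v) (hcv : c ≠ v) :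
    ∃ c' ∈ chain D E v, E c' = compIn G (E c \ {c}) v := by
  obtain ⟨c', -, hc'⟩ := hE.comp hc.1 hcv.symm
  refine ⟨c', ⟨hc' ▸ mem_compIn_self ⟨hc.1, hcv.symm⟩, ?_⟩, hc'⟩
  exact hc' ▸ compIn_subset.trans (Set.sdiff_subset.trans hc.2)

theorem chain_subset_next (hE : IsDescMap G Set.univ E)
    (hc' : c' ∈ chain D E v) (hmem : c' ∈ E c) (hne : c' ≠ c) :
    E c' ⊆ compIn G (E c \ {c}) v :=
  hE.subset_compIn hc'.1 (hE.trans hmem) fun h => hne (hE.antisymm hmem h)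

theorem cutPart_disjoint [Finite V] (hE : IsDescMap G Set.univ E) (hc : c ∈ chain D E v)
    (hc' : c' ∈ chain D E v) (hx : x ∈ cutPart G E v c) (hx' : x ∈ cutPart G E v c') : c = c' := by
  by_contra hne
  rcases hE.laminar hc.1 hc'.1 with h | h
  · exact hx'.2 (chain_subset_next hE hc h hne hx.1)
  · exact hx.2 (chain_subset_next hE hc' h (Ne.symm hne) hx'.1)

theorem mem_cutPart_of_child [Finite V] (hE : IsDescMap G Set.univ E) (hc : c ∈ chain D E v)
    (hu : u ∈ childSet G D v) (hx : x ∈ cutPart G E v c) (hxu : x ∈ chainUnion D E u) :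
    u ∈ cutPart G E v c := by
  obtain ⟨e, he, hxe⟩ := hxu
  have hve : v ∉ E e := fun h => IsDescMap.notMem_of_mem_childSet hu (he.2 h)
  have hce : c ∉ E e := fun h => hve (hE.trans h hc.1)
  have hec : e ∈ E c := (hE.laminar hxe hx.1).resolve_right hce
  refine ⟨hE.trans hec he.1, fun huK => hx.2 ?_⟩
  rw [← compIn_eq_of_mem huK]
  exact hE.subset_compIn he.1 (hE.trans hec) hce hxe

theorem cutPart_subset_slackPart [Finite V] (hE : IsDescMap G Set.univ E) (hc : c ∈ chain D E v)
    (hcv : c ≠ v) (hP : ¬ ∃ u ∈ childSet G D v, u ∈ cutPart G E v c) :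
    cutPart G E v c ⊆ slackPart G D E v := by
  refine fun x hx => ⟨hc.2 hx.1, ?_, fun u hu hxu => hP ⟨u, hu, mem_cutPart_of_child hE hc hu hx hxu⟩⟩
  rintro rfl
  exact hx.2 (mem_compIn_self ⟨hc.1, hcv.symm⟩)

open Classical in
theorem chain_sum_le [Fintype V] {w : V → ℝ} (hw : ∀ x, 0 ≤ w x)
    (hE : IsDescMap G Set.univ E) (hcent : ∀ c, IsCentroid G w (E c) c) (P : V → Prop) (n : ℕ) :
    ∀ c ∈ chain D E v, (E c).ncard = n →
      ∑ b with b ∈ chain D E v ∧ b ∈ E c, wsum w (E b) ≤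
        (2 - (1 / 2) ^ (Finset.card {b | (b ∈ chain D E v ∧ b ∈ E c) ∧ b ≠ v ∧ P b})) *
          wsum w (E c) +
        ∑ b with (b ∈ chain D E v ∧ b ∈ E c) ∧ b ≠ v ∧ ¬ P b, wsum w (cutPart G E v b) := by
  induction n using Nat.strong_induction_on with
  | _ n ih =>
    intro c hc hn
    have hpos : 0 ≤ wsum w (E c) := wsum_nonneg hw
    by_cases hcv : c = v
    · subst hcv
      have hset : ∀ b, (b ∈ chain D E c ∧ b ∈ E c) ↔ b = c := fun b =>
        ⟨fun h => hE.antisymm h.2 h.1.1, by rintro rfl; exact ⟨hc, hc.1⟩⟩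
      simp only [hset]
      have h0 : ∀ (Q : V → Prop) [DecidablePred Q], (Finset.univ.filter fun b => b = c ∧ b ≠ c ∧ Q b) = ∅ := by
        intro Q _
        ext b
        simp only [Finset.mem_filter, Finset.mem_univ, true_and, Finset.notMem_empty, iff_false]
        tauto
      have h1 : (Finset.univ.filter fun b => b = c) = {c} := by
        ext b
        simp
      rw [h0, h0, h1, Finset.sum_singleton, Finset.card_empty, pow_zero, Finset.sum_empty]
      linarith
    · obtain ⟨c', hc', hEc'⟩ := exists_next hE hc hcv
      have hsub : E c' ⊆ E c := hEc' ▸ compIn_subset.trans Set.sdiff_subset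
      have hcc' : c ∉ E c' := by
        rw [hEc']
        exact fun h => (compIn_subset h).2 rfl
      have hlt : (E c').ncard < n := by
        rw [← hn]
        exact Set.ncard_lt_ncard ⟨hsub, fun hle => hcc' (hle (hE.self_mem trivial))⟩
          (Set.toFinite _)
      have hhalf : wsum w (E c') ≤ wsum w (E c) / 2 :=
        hEc' ▸ (hcent c).2 v ⟨hc.1, Ne.symm hcv⟩
      have hcut : wsum w (cutPart G E v c) = wsum w (E c) - wsum w (E c') := by
        rw [cutPart, ← hEc', wsum_diff_of_subset hsub]
      have hpos' : 0 ≤ wsum w (E c') := wsum_nonneg hw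
      have key := ih _ hlt c' hc' rfl
      have hset : ∀ b, (b ∈ chain D E v ∧ b ∈ E c) ↔ b = c ∨ (b ∈ chain D E v ∧ b ∈ E c') := by
        intro b
        constructor
        · rintro ⟨hb, hbc⟩
          by_cases hne : b = c
          · exact .inl hne
          · exact .inr ⟨hb, hEc' ▸ chain_subset_next hE hb hbc hne (hE.self_mem trivial)⟩
        · rintro (rfl | ⟨hb, hbc⟩)
          · exact ⟨hc, hE.self_mem trivial⟩
          · exact ⟨hb, hsub hbc⟩
      have hins : ∀ (Q : V → Prop) [DecidablePred Q], Q c →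
          (Finset.univ.filter fun b => (b ∈ chain D E v ∧ b ∈ E c) ∧ Q b) =
            insert c (Finset.univ.filter fun b => (b ∈ chain D E v ∧ b ∈ E c') ∧ Q b) := by
        intro Q _ hQ
        ext b
        simp only [Finset.mem_filter, Finset.mem_univ, true_and, Finset.mem_insert, hset]
        constructor
        · rintro ⟨h | h, h'⟩
          · exact .inl h
          · exact .inr ⟨h, h'⟩
        · rintro (rfl | ⟨h, h'⟩)
          · exact ⟨.inl rfl, hQ⟩
          · exact ⟨.inr h, h'⟩
      have hsame : ∀ (Q : V → Prop) [DecidablePred Q], ¬ Q c →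
          (Finset.univ.filter fun b => (b ∈ chain D E v ∧ b ∈ E c) ∧ Q b) =
            Finset.univ.filter fun b => (b ∈ chain D E v ∧ b ∈ E c') ∧ Q b := by
        intro Q _ hQ
        ext b
        simp only [Finset.mem_filter, Finset.mem_univ, true_and, hset]
        constructor
        · rintro ⟨rfl | h, h'⟩
          · exact absurd h' hQ
          · exact ⟨h, h'⟩
        · exact fun ⟨h, h'⟩ => ⟨.inr h, h'⟩
      have hnot : ∀ (Q : V → Prop) [DecidablePred Q],
          c ∉ Finset.univ.filter fun b => (b ∈ chain D E v ∧ b ∈ E c') ∧ Q b := by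
        intro Q _ h
        exact hcc' (Finset.mem_filter.1 h).2.1.2
      have hall := hins (fun _ => True) trivial
      have hallnot := hnot fun _ => True
      simp only [and_true] at hall hallnot
      rw [hall, Finset.sum_insert hallnot]
      by_cases hPc : P c
      · rw [hins (fun b => b ≠ v ∧ P b) ⟨hcv, hPc⟩, Finset.card_insert_of_notMem (hnot _),
          hsame (fun b => b ≠ v ∧ ¬ P b) fun h => h.2 hPc, pow_succ]
        generalize Finset.card _ = m at key ⊢
        have hm : (1 / 2 : ℝ) ^ m ≤ 1 := pow_le_one₀ (by norm_num) (by norm_num)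
        nlinarith
      · rw [hsame (fun b => b ≠ v ∧ P b) fun h => hPc h.2,
          hins (fun b => b ≠ v ∧ ¬ P b) ⟨hcv, hPc⟩, Finset.sum_insert (hnot _), hcut]
        generalize Finset.card _ = m at key ⊢
        have hm : (1 / 2 : ℝ) ^ m ≤ 1 := pow_le_one₀ (by norm_num) (by norm_num)
        nlinarith

open Classical in
theorem sum_chain_le [Fintype V] {w : V → ℝ} (hw : ∀ x, 0 ≤ w x)
    (hD : IsDescMap G Set.univ D) (hE : IsDescMap G Set.univ E)
    (hcent : ∀ c, IsCentroid G w (E c) c) {Δ : ℕ} (hΔ : (G.neighborSet v).ncard ≤ Δ) :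
    ∑ b with b ∈ chain D E v, wsum w (E b) ≤
      (2 - 1 / 2 ^ Δ) * (wsum w (chainUnion D E v) + wsum w (slackPart G D E v)) := by
  have hα : (1 : ℝ) ≤ 2 - 1 / 2 ^ Δ := by
    rw [← one_div_pow]
    have : (1 / 2 : ℝ) ^ Δ ≤ 1 := pow_le_one₀ (by norm_num) (by norm_num)
    linarith
  have hU : 0 ≤ wsum w (chainUnion D E v) := wsum_nonneg hw
  have hX : 0 ≤ wsum w (slackPart G D E v) := wsum_nonneg hw
  rcases (chain D E v).eq_empty_or_nonempty with hemp | hne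
  · simp only [hemp, Set.mem_empty_iff_false, Finset.filter_false, Finset.sum_empty]
    positivity
  obtain ⟨c, hc, hmax⟩ := Set.exists_max_image (chain D E v) (fun c => (E c).ncard)
    (Set.toFinite _) hne
  have hall : ∀ b ∈ chain D E v, b ∈ E c := by
    intro b hb
    rcases hE.laminar hb.1 hc.1 with h | h
    · exact h
    · have heq : E c = E b :=
        Set.eq_of_subset_of_ncard_le (hE.trans h) (hmax b hb) (Set.toFinite _)
      exact heq ▸ hE.self_mem trivial
  set P : V → Prop := fun b => ∃ u ∈ childSet G D v, u ∈ cutPart G E v b with hP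
  have key := chain_sum_le hw hE hcent P _ c hc rfl
  have hset : ∀ b, (b ∈ chain D E v ∧ b ∈ E c) ↔ b ∈ chain D E v := fun b =>
    ⟨fun h => h.1, fun h => ⟨h, hall b h⟩⟩
  simp only [hset] at key
  have hcard : Finset.card {b | b ∈ chain D E v ∧ b ≠ v ∧ P b} ≤ Δ := by
    refine le_trans ?_ ((hD.ncard_childSet_le v).trans hΔ)
    rw [← Set.ncard_coe_finset]
    have hex : ∀ b ∈ {b | b ∈ chain D E v ∧ b ≠ v ∧ P b},
        ∃ u ∈ childSet G D v, u ∈ cutPart G E v b := fun b hb => hb.2.2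
    choose! f hf hfc using hex
    rw [Finset.coe_filter_univ]
    refine Set.ncard_le_ncard_of_injOn f hf (fun b hb b' hb' he => ?_) (Set.toFinite _)
    exact cutPart_disjoint hE hb.1 hb'.1 (hfc b hb) (he ▸ hfc b' hb')
  have hpow : (1 / 2 : ℝ) ^ Δ ≤
      (1 / 2) ^ Finset.card {b | b ∈ chain D E v ∧ b ≠ v ∧ P b} :=
    pow_le_pow_of_le_one (by norm_num) (by norm_num) hcard
  have hslack : ∑ b with b ∈ chain D E v ∧ b ≠ v ∧ ¬ P b, wsum w (cutPart G E v b) ≤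
      wsum w (slackPart G D E v) := by
    refine sum_wsum_le_of_disjoint hw _ _ (fun b hb => ?_) fun b hb b' hb' x hx hx' => ?_
    · have hb := (Finset.mem_filter.1 hb).2
      exact cutPart_subset_slackPart hE hb.1 hb.2.1 hb.2.2
    · exact cutPart_disjoint hE (Finset.mem_filter.1 hb).2.1 (Finset.mem_filter.1 hb').2.1 hx hx'
  have hEU : wsum w (E c) ≤ wsum w (chainUnion D E v) := wsum_mono hw fun x hx => ⟨c, hc, hx⟩
  have hEc : 0 ≤ wsum w (E c) := wsum_nonneg hw
  rw [← one_div_pow] at hα ⊢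
  generalize (1 / 2 : ℝ) ^ Δ = a at *
  generalize (1 / 2 : ℝ) ^ _ = b at *
  nlinarith

open Classical in
/-- Pointwise, `chainUnion` and `slackPart` are jointly paid for by the descendant sets. -/
theorem card_chainUnion_add_card_slackPart_le [Fintype V] (hD : IsDescMap G Set.univ D) (x : V) :
    Finset.card {v | x ∈ chainUnion D E v} + Finset.card {v | x ∈ slackPart G D E v} ≤
      Finset.card {v | x ∈ D v} := by
  obtain ⟨r, hr⟩ := hD.root
  have hpar : ∀ u, u ≠ r → ∃ v, u ∈ childSet G D v := fun u hu =>
    hD.exists_parent hr trivial hu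
  choose! p hp using hpar
  have hUD : ∀ {v}, x ∈ chainUnion D E v → x ∈ D v := fun ⟨_, hc, hx⟩ => hc.2 hx
  have hDp : ∀ {u}, u ≠ r → x ∈ D u → x ∈ D (p u) := fun hu hx =>
    hD.trans (hp _ hu).1.1 hx
  have hpx : ∀ {u}, u ≠ r → x ∈ D u → p u ≠ x := fun hu hx h =>
    IsDescMap.notMem_of_mem_childSet (hp _ hu) (h ▸ hx)
  set g : V → V := fun u => if u = r then x else p u with hg
  have hinj : Set.InjOn g (Finset.univ.filter fun v => x ∈ chainUnion D E v : Finset V) := by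
    intro u hu u' hu' he
    simp only [Finset.coe_filter, Finset.mem_univ, true_and] at hu hu'
    simp only [hg] at he
    split_ifs at he with h h' h'
    · rw [h, h']
    · exact absurd he.symm (hpx h' (hUD hu'))
    · exact absurd he (hpx h (hUD hu))
    · exact hD.eq_of_mem_childSet (hp u h) (he ▸ hp u' h') (hUD hu) (hUD hu')
  rw [← Finset.card_image_of_injOn hinj, ← Finset.card_union_of_disjoint]
  · refine Finset.card_le_card fun v hv => ?_
    simp only [Finset.mem_union, Finset.mem_image, Finset.mem_filter, Finset.mem_univ,
      true_and] at hv ⊢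
    rcases hv with ⟨u, hu, rfl⟩ | hv
    · simp only [hg]
      split_ifs with h
      · exact hD.self_mem trivial
      · exact hDp h (hUD hu)
    · exact hv.1
  · rw [Finset.disjoint_left]
    intro v hv hv'
    simp only [Finset.mem_image, Finset.mem_filter, Finset.mem_univ, true_and] at hv hv'
    obtain ⟨u, hu, rfl⟩ := hv
    simp only [hg] at hv'
    split_ifs at hv' with h
    · exact hv'.2.1 rfl
    · exact hv'.2.2 u (hp u h) hu

theorem sum_wsum_le [Fintype V] {w : V → ℝ} (hw : ∀ x, 0 ≤ w x)
    (hD : IsDescMap G Set.univ D) (hE : IsDescMap G Set.univ E)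
    (hcent : ∀ c, IsCentroid G w (E c) c) {Δ : ℕ} (hΔ : ∀ v, (G.neighborSet v).ncard ≤ Δ) :
    ∑ c, wsum w (E c) ≤ (2 - 1 / 2 ^ Δ) * ∑ v, wsum w (D v) := by
  classical
  have hα : (0 : ℝ) ≤ 2 - 1 / 2 ^ Δ := by
    rw [← one_div_pow]
    have : (1 / 2 : ℝ) ^ Δ ≤ 1 := pow_le_one₀ (by norm_num) (by norm_num)
    linarith
  calc ∑ c, wsum w (E c) ≤ ∑ c, ∑ v, if c ∈ chain D E v then wsum w (E c) else 0 := by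
        refine Finset.sum_le_sum fun c _ => ?_
        obtain ⟨v, hv, hsub⟩ := hD.exists_top (hE.conn (v := c) trivial) (Set.subset_univ _)
        have hc : c ∈ chain D E v := ⟨hv, hsub⟩
        calc wsum w (E c) = if c ∈ chain D E v then wsum w (E c) else 0 := by rw [if_pos hc]
          _ ≤ _ := Finset.single_le_sum
            (f := fun v => if c ∈ chain D E v then wsum w (E c) else 0)
            (fun u _ => by split_ifs; exacts [wsum_nonneg hw, le_rfl]) (Finset.mem_univ v)
    _ = ∑ v, ∑ c with c ∈ chain D E v, wsum w (E c) := by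
        rw [Finset.sum_comm]
        exact Finset.sum_congr rfl fun v _ => (Finset.sum_filter _ _).symm
    _ ≤ ∑ v, (2 - 1 / 2 ^ Δ) * (wsum w (chainUnion D E v) + wsum w (slackPart G D E v)) :=
        Finset.sum_le_sum fun v _ => sum_chain_le hw hD hE hcent (hΔ v)
    _ = (2 - 1 / 2 ^ Δ) * (∑ v, wsum w (chainUnion D E v) + ∑ v, wsum w (slackPart G D E v)) := by
        rw [← Finset.mul_sum, Finset.sum_add_distrib]
    _ ≤ (2 - 1 / 2 ^ Δ) * ∑ v, wsum w (D v) := by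
        refine mul_le_mul_of_nonneg_left ?_ hα
        simp only [sum_wsum_eq]
        rw [← Finset.sum_add_distrib]
        refine Finset.sum_le_sum fun x _ => ?_
        rw [← add_mul]
        refine mul_le_mul_of_nonneg_right ?_ (hw x)
        exact_mod_cast card_chainUnion_add_card_slackPart_le hD x

end Chains

theorem cost_eq_sum_wsum [Fintype V] (w : V → ℝ) {T : RTree V} (hT : T.vertSet = Set.univ) :
    cost w T = ∑ v, wsum w (T.descSet v) := by
  classical
  rw [sum_wsum_eq, cost, hT, finsum_mem_univ, finsum_eq_sum_of_fintype]
  refine Finset.sum_congr rfl fun x _ => ?_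
  rw [mul_comm, RTree.depth, Set.ncard_eq_toFinset_card']
  congr 3
  ext v
  rw [Set.mem_toFinset, Finset.mem_filter]
  exact ⟨fun h => ⟨Finset.mem_univ _, h⟩, fun h => h.2⟩

theorem centroid_tree_bounded_degree_approx {V : Type} [Fintype V]
    (G : SimpleGraph V) (hG : G.IsTree) (Δ : ℕ)
    (hΔ : ∀ v : V, (G.neighborSet v).ncard ≤ Δ)
    (w : V → ℝ) (hw : ∀ x, 0 ≤ w x) :
    centCost G w Set.univ ≤ (2 - 1 / 2 ^ Δ) * OPT G w Set.univ := by
  have hα : (1 : ℝ) ≤ 2 - 1 / 2 ^ Δ := by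
    rw [← one_div_pow]
    have : (1 / 2 : ℝ) ^ Δ ≤ 1 := pow_le_one₀ (by norm_num) (by norm_num)
    linarith
  have hcost : ∀ T : RTree V, T.vertSet = Set.univ → 0 ≤ cost w T := fun T hT => by
    rw [cost_eq_sum_wsum w hT]
    exact Finset.sum_nonneg fun v _ => wsum_nonneg hw
  have hconn : ConnIn G Set.univ := by
    obtain ⟨v⟩ := hG.1.nonempty
    exact ⟨⟨v, trivial⟩, fun x _ y _ => ⟨(hG.1.preconnected x y).some, fun _ _ => trivial⟩⟩
  have hOPT : 0 ≤ OPT G w Set.univ := by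
    refine Real.sInf_nonneg ?_
    rintro _ ⟨T, hT, rfl⟩
    exact hcost T (IsSearchTree.vertSet_eq hT)
  refine Real.sSup_le ?_ (mul_nonneg (by linarith) hOPT)
  rintro _ ⟨C, ⟨hC, hcent⟩, rfl⟩
  rw [mul_comm, ← div_le_iff₀ (by linarith)]
  refine le_csInf ⟨_, C, hC, rfl⟩ ?_
  rintro _ ⟨T, hT, rfl⟩
  obtain ⟨hE, hsub⟩ := hC.isDescMap hconn
  rw [div_le_iff₀ (by linarith), mul_comm, cost_eq_sum_wsum w hC.vertSet_eq,
    cost_eq_sum_wsum w (IsSearchTree.vertSet_eq hT)]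
  refine sum_wsum_le hw (IsSearchTree.isDescMap hT hconn).1 hE (fun c => ?_) hΔ
  obtain ⟨t, ht, rfl, hvs⟩ := hsub c trivial
  exact hvs ▸ hcent t ht
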